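/- arXiv:physics/0309090 — 2 statements merged into one kernel-verified Lean document; each statement's English description precedes it below -/
import Mathlib

section
/- If a smooth compactly supported symmetric 2-tensor field u on ℝ² satisfies ∂₁²u₂₂ + ∂₂²u₁₁ − 2∂₁∂₂u₁₂ = 0, then there exists a vector field v on ℝ², vanishing at infinity, with u_{ij} = (∂_i v_j + ∂_j v_i)/2. -/
open MeasureTheory Filter

/-- Partial derivative in the `i`-th coordinate direction on `ℝ²`. -/
noncomputable def pd (i : Fin 2) (f : EuclideanSpace ℝ (Fin 2) → ℝ)
    (x : EuclideanSpace ℝ (Fin 2)) : ℝ :=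
  fderiv ℝ f x (EuclideanSpace.single i 1)


open Set Topology

local notation "E2" => EuclideanSpace ℝ (Fin 2)

noncomputable def svE0 : E2 := EuclideanSpace.single 0 1

/-- weighted half-line integral -/
noncomputable def svT (w : ℝ → ℝ) (f : E2 → ℝ) (X : E2) : ℝ :=
  ∫ t in Ioi (0:ℝ), w t * f (X - t • svE0)

lemma svE0_norm : ‖svE0‖ = 1 := by simp [svE0]

lemma sv_line_cs {F : Type*} [NormedAddCommGroup F] {f : E2 → F} (hc : HasCompactSupport f) (X : E2) :
    HasCompactSupport (fun t : ℝ => f (X - t • svE0)) := by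
  obtain ⟨R, hR⟩ := hc.isCompact.isBounded.subset_closedBall (0 : E2)
  refine HasCompactSupport.intro (isCompact_closedBall (0:ℝ) (R + ‖X‖)) ?_
  intro t ht
  by_contra h
  apply ht
  have h1 := hR (subset_tsupport f h)
  rw [mem_closedBall_zero_iff] at h1 ⊢
  have h2 : ‖t • svE0‖ ≤ ‖X‖ + ‖X - t • svE0‖ := by
    have := norm_sub_le X (X - t • svE0)
    simpa using this
  rw [norm_smul, svE0_norm, mul_one] at h2
  linarith

lemma sv_int {F : Type*} [NormedAddCommGroup F] [NormedSpace ℝ F] {f : E2 → F}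
    (hc : HasCompactSupport f) (hf : Continuous f)
    {w : ℝ → ℝ} (hw : Continuous w) (X : E2) :
    Integrable (fun t : ℝ => w t • f (X - t • svE0)) := by
  apply Continuous.integrable_of_hasCompactSupport
  · fun_prop
  · exact (sv_line_cs hc X).smul_left

lemma sv_hasFDerivAt {f : E2 → ℝ} (hc : HasCompactSupport f) (hf : ContDiff ℝ (⊤ : ℕ∞) f)
    {w : ℝ → ℝ} (hw : Continuous w) (X : E2) :
    HasFDerivAt (svT w f) (∫ t in Ioi (0:ℝ), w t • fderiv ℝ f (X - t • svE0)) X := by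
  have hf1 : Continuous (fderiv ℝ f) := hf.continuous_fderiv (by simp)
  have hc1 : HasCompactSupport (fderiv ℝ f) := hc.fderiv ℝ
  obtain ⟨C, hC⟩ := hf1.bounded_above_of_compact_support hc1
  obtain ⟨R, hR⟩ := hc1.isCompact.isBounded.subset_closedBall (0 : E2)
  apply hasFDerivAt_integral_of_dominated_of_fderiv_le
    (bound := (Icc 0 (R + ‖X‖ + 1)).indicator (fun t => |w t| * C))
    (F' := fun Y t => w t • fderiv ℝ f (Y - t • svE0)) (Metric.ball_mem_nhds X zero_lt_one)
  · refine Eventually.of_forall fun Y => ?_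
    have := hf.continuous
    exact Continuous.aestronglyMeasurable (by fun_prop)
  · exact (sv_int hc hf.continuous hw X).integrableOn
  · exact Continuous.aestronglyMeasurable (by fun_prop)
  · rw [ae_restrict_iff' measurableSet_Ioi]
    refine Eventually.of_forall fun t ht Y hY => ?_
    by_cases htm : t ∈ Icc 0 (R + ‖X‖ + 1)
    · rw [indicator_of_mem htm, norm_smul, Real.norm_eq_abs]
      exact mul_le_mul_of_nonneg_left (hC _) (abs_nonneg _)
    · rw [indicator_of_notMem htm]
      have : fderiv ℝ f (Y - t • svE0) = 0 := by
        by_contra h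
        have h1 := hR (subset_tsupport _ h)
        rw [mem_closedBall_zero_iff] at h1
        have h2 : ‖t • svE0‖ ≤ ‖Y‖ + ‖Y - t • svE0‖ := by
          have := norm_sub_le Y (Y - t • svE0)
          simpa using this
        rw [norm_smul, svE0_norm, mul_one, Real.norm_eq_abs] at h2
        have h3 : ‖Y‖ ≤ ‖X‖ + 1 := by
          have := norm_le_norm_add_norm_sub' Y X
          rw [mem_ball_iff_norm] at hY
          linarith
        apply htm
        refine ⟨le_of_lt ht, ?_⟩
        linarith [le_abs_self t]
      simp [this]
  · apply Integrable.integrableOn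
    rw [integrable_indicator_iff measurableSet_Icc]
    exact ContinuousOn.integrableOn_Icc (by fun_prop)
  · refine Eventually.of_forall fun t Y _ => ?_
    have h := ((hf.differentiable (by simp)) (Y - t • svE0)).hasFDerivAt.comp Y
      ((hasFDerivAt_id Y).sub_const (t • svE0))
    simpa using! h.const_mul (w t)

lemma sv_pd_contDiff {f : E2 → ℝ} (hf : ContDiff ℝ (⊤ : ℕ∞) f) (i : Fin 2) :
    ContDiff ℝ (⊤ : ℕ∞) (pd i f) := by
  unfold pd
  exact (hf.fderiv_right (m := (⊤ : ℕ∞)) (by simp)).clm_apply contDiff_const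

lemma sv_pd_cs {f : E2 → ℝ} (hc : HasCompactSupport f) (i : Fin 2) :
    HasCompactSupport (pd i f) :=
  hc.fderiv_apply ℝ _

lemma sv_pd {f : E2 → ℝ} (hc : HasCompactSupport f) (hf : ContDiff ℝ (⊤ : ℕ∞) f)
    {w : ℝ → ℝ} (hw : Continuous w) (i : Fin 2) (X : E2) :
    pd i (svT w f) X = svT w (pd i f) X := by
  have hi : Integrable (fun t : ℝ => w t • fderiv ℝ f (X - t • svE0)) (volume.restrict (Ioi 0)) :=
    (sv_int (hc.fderiv ℝ) (hf.continuous_fderiv (by simp)) hw X).integrableOn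
  unfold pd
  rw [(sv_hasFDerivAt hc hf hw X).fderiv, ContinuousLinearMap.integral_apply hi]
  simp [svT]

lemma sv_diff {f : E2 → ℝ} (hc : HasCompactSupport f) (hf : ContDiff ℝ (⊤ : ℕ∞) f)
    {w : ℝ → ℝ} (hw : Continuous w) : Differentiable ℝ (svT w f) :=
  fun X => (sv_hasFDerivAt hc hf hw X).differentiableAt

lemma sv_line_deriv {f : E2 → ℝ} (hf : ContDiff ℝ (⊤ : ℕ∞) f) (X : E2) (t : ℝ) :
    HasDerivAt (fun t : ℝ => f (X - t • svE0)) (- pd 0 f (X - t • svE0)) t := by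
  have h1 : HasDerivAt (fun t : ℝ => X - t • svE0) (-svE0) t := by
    simpa using ((hasDerivAt_id t).smul_const svE0).const_sub X
  have h2 := ((hf.differentiable (by simp)) (X - t • svE0)).hasFDerivAt.comp_hasDerivAt t h1
  simpa [pd, svE0] using! h2

lemma sv_tendsto {g : ℝ → ℝ} (h : HasCompactSupport g) : Tendsto g atTop (𝓝 0) :=
  h.is_zero_at_infty.mono_left atTop_le_cocompact

lemma sv_I {f : E2 → ℝ} (hc : HasCompactSupport f) (hf : ContDiff ℝ (⊤ : ℕ∞) f) (X : E2) :
    svT (fun _ => 1) (pd 0 f) X = f X := by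
  have := integral_Ioi_of_hasDerivAt_of_tendsto' (a := 0) (m := 0)
    (f := fun t : ℝ => f (X - t • svE0))
    (f' := fun t : ℝ => - pd 0 f (X - t • svE0)) (fun t _ => sv_line_deriv hf X t) ?_
    (sv_tendsto (sv_line_cs hc X))
  · rw [integral_neg] at this
    simp [svT] at this ⊢
    linarith
  · have := (sv_int (sv_pd_cs hc 0) (sv_pd_contDiff hf 0).continuous
      (w := fun _ => -1) (by fun_prop) X).integrableOn (s := Ioi 0)
    simpa using this

lemma sv_J {f : E2 → ℝ} (hc : HasCompactSupport f) (hf : ContDiff ℝ (⊤ : ℕ∞) f) (X : E2) :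
    svT (fun t => t) (pd 0 f) X = svT (fun _ => 1) f X := by
  have i1 := (sv_int (sv_pd_cs hc 0) (sv_pd_contDiff hf 0).continuous
      (w := fun t => t) (by fun_prop) X).integrableOn (s := Ioi 0)
  have i2 := (sv_int hc hf.continuous
      (w := fun t => 1) (by fun_prop) X).integrableOn (s := Ioi 0)
  have := integral_Ioi_of_hasDerivAt_of_tendsto' (a := 0) (m := 0)
    (f := fun t : ℝ => t * f (X - t • svE0))
    (f' := fun t : ℝ => 1 • f (X - t • svE0) - t • pd 0 f (X - t • svE0)) (fun t _ => ?_) ?_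
    (sv_tendsto (sv_line_cs hc X).mul_left)
  · have h3 := integral_sub i2 i1
    simp only [smul_eq_mul, one_mul, one_smul, zero_mul, sub_zero] at this h3
    simp only [svT, one_mul]
    linarith
  · have := (hasDerivAt_id t).mul (sv_line_deriv hf X t)
    refine this.congr_deriv ?_
    simp
    ring
  · simpa using! i2.sub i1

lemma sv_zero {w : ℝ → ℝ} {f : E2 → ℝ} {X : E2} (h : ∀ t : ℝ, t > 0 → f (X - t • svE0) = 0) :
    svT w f X = 0 := by
  unfold svT
  rw [setIntegral_congr_fun (g := fun _ => (0:ℝ)) measurableSet_Ioi]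
  · simp
  · intro t ht
    simp [h t ht]

/-- constancy along vertical lines -/
lemma sv_vert {g : E2 → ℝ} {R : ℝ} (hg : Differentiable ℝ g)
    (h1 : ∀ X : E2, R < X 0 → pd 1 g X = 0) (h2 : ∀ X : E2, R < X 1 → g X = 0) :
    ∀ X : E2, R < X 0 → g X = 0 := by
  intro X hX
  set e : E2 := EuclideanSpace.single 1 1 with he
  have hd : ∀ s : ℝ, HasDerivAt (fun s : ℝ => g (X + s • e)) (pd 1 g (X + s • e)) s := by
    intro s
    have h1 : HasDerivAt (fun t : ℝ => X + t • e) e s := by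
      simpa using ((hasDerivAt_id s).smul_const e).const_add X
    exact (hg (X + s • e)).hasFDerivAt.comp_hasDerivAt s h1
  have hconst := is_const_of_deriv_eq_zero (fun s => (hd s).differentiableAt)
    (fun s => by
      rw [(hd s).deriv]
      apply h1
      simpa [he] using hX) 0 (R - X 1 + 1)
  simp only [zero_smul, add_zero] at hconst
  rw [hconst]
  apply h2
  simp [he]
  linarith

/-- If a smooth compactly supported symmetric 2-tensor field on `ℝ²` satisfies the
Saint-Venant condition, then it is the symmetrized derivative of a vector field
vanishing at infinity. -/
theorem saint_venant_implies_potential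
    (u : EuclideanSpace ℝ (Fin 2) → Fin 2 → Fin 2 → ℝ)
    (hu : ∀ i j, ContDiff ℝ (⊤ : ℕ∞) (fun x => u x i j))
    (huc : ∀ i j, HasCompactSupport (fun x => u x i j))
    (husym : ∀ x i j, u x i j = u x j i)
    (hSV : ∀ x, pd 0 (pd 0 (fun y => u y 1 1)) x + pd 1 (pd 1 (fun y => u y 0 0)) x -
      2 * pd 0 (pd 1 (fun y => u y 0 1)) x = 0) :
    ∃ v : EuclideanSpace ℝ (Fin 2) → EuclideanSpace ℝ (Fin 2),
      (∀ i, Differentiable ℝ (fun x => v x i)) ∧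
      Tendsto v (cocompact (EuclideanSpace ℝ (Fin 2))) (nhds 0) ∧
      ∀ x i j, u x i j = (pd i (fun y => v y j) x + pd j (fun y => v y i) x) / 2 := by
  set a : E2 → ℝ := fun y => u y 0 0 with ha
  set b : E2 → ℝ := fun y => u y 0 1 with hb
  set c : E2 → ℝ := fun y => u y 1 1 with hcdef
  have sa : ContDiff ℝ (⊤ : ℕ∞) a := hu 0 0
  have sb : ContDiff ℝ (⊤ : ℕ∞) b := hu 0 1
  have sc : ContDiff ℝ (⊤ : ℕ∞) c := hu 1 1
  have ca : HasCompactSupport a := huc 0 0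
  have cb : HasCompactSupport b := huc 0 1
  have cc : HasCompactSupport c := huc 1 1
  have sa1 := sv_pd_contDiff sa 1
  have ca1 := sv_pd_cs ca 1
  have sb1 := sv_pd_contDiff sb 1
  have cb1 := sv_pd_cs cb 1
  have sc0 := sv_pd_contDiff sc 0
  have cc0 := sv_pd_cs cc 0
  have hw1 : Continuous (fun _ : ℝ => (1:ℝ)) := by fun_prop
  have hw2 : Continuous (fun t : ℝ => t) := by fun_prop
  have key : ∀ (w : ℝ → ℝ), Continuous w → ∀ X, svT w (pd 1 (pd 1 a)) X =
      2 * svT w (pd 0 (pd 1 b)) X - svT w (pd 0 (pd 0 c)) X := by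
    intro w hw X
    have i1 := (sv_int (sv_pd_cs cb1 0) (sv_pd_contDiff sb1 0).continuous hw X).integrableOn
      (s := Ioi 0)
    have i2 := (sv_int (sv_pd_cs cc0 0) (sv_pd_contDiff sc0 0).continuous hw X).integrableOn
      (s := Ioi 0)
    simp only [smul_eq_mul] at i1 i2
    unfold svT
    rw [← integral_const_mul, ← integral_sub (i1.const_mul 2) i2]
    congr 1
    ext t
    have := hSV (X - t • svE0)
    have h3 : pd 1 (pd 1 a) (X - t • svE0) =
      2 * pd 0 (pd 1 b) (X - t • svE0) - pd 0 (pd 0 c) (X - t • svE0) := by linarith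
    rw [h3]; ring
  set p : E2 → ℝ := svT (fun _ => 1) a with hp
  set q : E2 → ℝ := fun X => 2 * svT (fun _ => 1) b X - svT (fun t => t) (pd 1 a) X with hq
  have dp : Differentiable ℝ p := sv_diff ca sa hw1
  have db := sv_diff cb sb hw1
  have dJ := sv_diff ca1 sa1 hw2
  have dq : Differentiable ℝ q := (db.const_mul 2).sub dJ
  have pdq : ∀ i X, pd i q X = 2 * svT (fun _ => 1) (pd i b) X
      - svT (fun t => t) (pd i (pd 1 a)) X := by
    intro i X
    rw [← sv_pd cb sb hw1, ← sv_pd ca1 sa1 hw2]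
    have h := (((db X).hasFDerivAt.const_mul 2).sub (dJ X).hasFDerivAt).fderiv
    have h' := congrArg (fun L => L (EuclideanSpace.single i 1)) h
    simp only [ContinuousLinearMap.sub_apply, ContinuousLinearMap.smul_apply, smul_eq_mul] at h'
    exact h'
  have e00 : ∀ X, pd 0 p X = a X := fun X => by
    rw [hp, sv_pd ca sa hw1, sv_I ca sa]
  have e11 : ∀ X, pd 1 q X = c X := fun X => by
    rw [pdq, key _ hw2, sv_J cb1 sb1, sv_J cc0 sc0, sv_I cc sc]; ring
  have e01 : ∀ X, pd 0 q X + pd 1 p X = 2 * b X := fun X => by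
    rw [pdq, hp, sv_pd ca sa hw1, sv_I cb sb, sv_J ca1 sa1]; ring
  have hp1 : pd 1 p = svT (fun _ => 1) (pd 1 a) := funext fun X => sv_pd ca sa hw1 1 X
  have e11p : ∀ X, pd 1 (pd 1 p) X = 2 * pd 1 b X - pd 0 c X := fun X => by
    rw [hp1, sv_pd ca1 sa1 hw1, key _ hw1, sv_I cb1 sb1, sv_I cc0 sc0]
  -- a common support radius
  obtain ⟨R, hR⟩ : ∃ R : ℝ, ∀ X : E2, (R < |X 0| ∨ R < |X 1|) →
      a X = 0 ∧ b X = 0 ∧ c X = 0 ∧ pd 1 a X = 0 ∧ pd 1 b X = 0 ∧ pd 0 c X = 0 := by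
    have one : ∀ {f : E2 → ℝ}, HasCompactSupport f → ∃ R : ℝ, ∀ X : E2, R < ‖X‖ → f X = 0 := by
      intro f hf
      obtain ⟨R, hR⟩ := hf.isCompact.isBounded.subset_closedBall (0 : E2)
      refine ⟨R, fun X hX => ?_⟩
      by_contra h
      have := hR (subset_tsupport f h)
      rw [mem_closedBall_zero_iff] at this
      linarith
    obtain ⟨R1, h1⟩ := one ca
    obtain ⟨R2, h2⟩ := one cb
    obtain ⟨R3, h3⟩ := one cc
    obtain ⟨R4, h4⟩ := one ca1
    obtain ⟨R5, h5⟩ := one cb1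
    obtain ⟨R6, h6⟩ := one cc0
    refine ⟨max R1 (max R2 (max R3 (max R4 (max R5 R6)))), fun X hX => ?_⟩
    have hX' : max R1 (max R2 (max R3 (max R4 (max R5 R6)))) < ‖X‖ := by
      rcases hX with h | h
      · exact h.trans_le (PiLp.norm_apply_le X 0)
      · exact h.trans_le (PiLp.norm_apply_le X 1)
    simp only [max_lt_iff] at hX'
    obtain ⟨g1, g2, g3, g4, g5, g6⟩ := hX'
    exact ⟨h1 X g1, h2 X g2, h3 X g3, h4 X g4, h5 X g5, h6 X g6⟩
  have shift0 : ∀ (X : E2) (t : ℝ), (X - t • svE0) 0 = X 0 - t := by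
    intro X t; simp [svE0]
  have shift1 : ∀ (X : E2) (t : ℝ), (X - t • svE0) 1 = X 1 := by
    intro X t; simp [svE0]
  have far : ∀ X : E2, (X 0 < -R ∨ R < |X 1|) → p X = 0 ∧ q X = 0 ∧ pd 1 p X = 0 := by
    intro X hX
    have hz : ∀ t : ℝ, t > 0 → R < |(X - t • svE0) 0| ∨ R < |(X - t • svE0) 1| := by
      intro t ht
      rw [shift0, shift1]
      rcases hX with h | h
      · left
        have := neg_abs_le (X 0 - t)
        linarith
      · exact Or.inr h
    have z1 : p X = 0 := sv_zero fun t ht => (hR _ (hz t ht)).1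
    have z2 : svT (fun _ => 1) b X = 0 := sv_zero fun t ht => (hR _ (hz t ht)).2.1
    have z3 : ∀ w, svT w (pd 1 a) X = 0 := fun w => sv_zero fun t ht => (hR _ (hz t ht)).2.2.2.1
    refine ⟨z1, ?_, ?_⟩
    · simp only [hq, z2, z3]; ring
    · rw [hp1, z3]
  have up : ∀ X : E2, R < X 1 → R < |X 1| := fun X h => h.trans_le (le_abs_self _)
  have rt : ∀ X : E2, R < X 0 → R < |X 0| := fun X h => h.trans_le (le_abs_self _)
  have r1 : ∀ X : E2, R < X 0 → pd 1 p X = 0 := by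
    apply sv_vert
    · rw [hp1]; exact sv_diff ca1 sa1 hw1
    · intro X hX
      have := hR X (Or.inl (rt X hX))
      rw [e11p, this.2.2.2.2.1, this.2.2.2.2.2]; ring
    · exact fun X hX => (far X (Or.inr (up X hX))).2.2
  have r2 : ∀ X : E2, R < X 0 → p X = 0 :=
    sv_vert dp r1 fun X hX => (far X (Or.inr (up X hX))).1
  have r3 : ∀ X : E2, R < X 0 → q X = 0 :=
    sv_vert dq (fun X hX => by rw [e11]; exact (hR X (Or.inl (rt X hX))).2.2.1)
      fun X hX => (far X (Or.inr (up X hX))).2.1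
  have out : ∀ X : E2, (R < |X 0| ∨ R < |X 1|) → p X = 0 ∧ q X = 0 := by
    intro X hX
    rcases hX with h | h
    · rcases lt_abs.1 h with h | h
      · exact ⟨r2 X h, r3 X h⟩
      · have := far X (Or.inl (by linarith))
        exact ⟨this.1, this.2.1⟩
    · have := far X (Or.inr h)
      exact ⟨this.1, this.2.1⟩
  refine ⟨fun X => !₂[p X, q X], ?_, ?_, ?_⟩
  · intro i
    fin_cases i
    · simpa using! dp
    · simpa using! dq
  · apply HasCompactSupport.is_zero_at_infty
    apply HasCompactSupport.intro (isCompact_closedBall (0 : E2) (R + R + 1 + |R|))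
    intro X hX
    have hX2 : R < |X 0| ∨ R < |X 1| := by
      by_contra hcon
      push Not at hcon
      apply hX
      rw [mem_closedBall_zero_iff]
      have h0 : 0 ≤ R := (abs_nonneg _).trans hcon.1
      rw [EuclideanSpace.norm_eq, Real.sqrt_le_left (by positivity)]
      simp only [Fin.sum_univ_two, Real.norm_eq_abs]
      have := abs_nonneg (X 0)
      have := abs_nonneg (X 1)
      nlinarith [abs_nonneg R, hcon.1, hcon.2]
    obtain ⟨h1, h2⟩ := out X hX2
    ext i
    fin_cases i <;> simp [h1, h2]
  · intro X i j
    have E0 : (fun y => (!₂[p y, q y] : E2) 0) = p := by ext; simp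
    have E1 : (fun y => (!₂[p y, q y] : E2) 1) = q := by ext; simp
    have g00 := e00 X
    have g01 := e01 X
    have g11 := e11 X
    have gs := husym X 1 0
    simp only [ha, hb, hcdef] at g00 g01 g11
    fin_cases i <;> fin_cases j <;> simp only [Fin.zero_eta, Fin.mk_one, E0, E1] <;> linarith
end

section
/- A smooth compactly supported symmetric 2-tensor field u on ℝ² has vanishing ray transform if and only if there exists a vector field v vanishing at infinity such that u_{ij} = (∂_i v_j + ∂_j v_i)/2. -/
open MeasureTheory Filter

open scoped Topology FourierTransform

abbrev E2 := EuclideanSpace ℝ (Fin 2)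

lemma line_emb (x e : E2) (he : e ≠ 0) : Topology.IsClosedEmbedding (fun t : ℝ => x + t • e) :=
  (Homeomorph.addLeft x).isClosedEmbedding.comp (isClosedEmbedding_smul_left he)

lemma line_integrable {F : Type*} [NormedAddCommGroup F] [NormedSpace ℝ F] (g : E2 → F)
    (hg : Continuous g) (hc : HasCompactSupport g) (x e : E2) (he : e ≠ 0) :
    Integrable (fun t : ℝ => g (x + t • e)) := by
  apply Continuous.integrable_of_hasCompactSupport (by fun_prop)
  exact hc.comp_isClosedEmbedding (line_emb x e he)

lemma decomp (ξ : E2) : ξ = ξ 0 • EuclideanSpace.single 0 (1:ℝ) + ξ 1 • EuclideanSpace.single 1 (1:ℝ) := by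
  ext i; fin_cases i <;> simp

lemma fderiv_pd (g : E2 → ℝ) (x ξ : E2) : fderiv ℝ g x ξ = ξ 0 * pd 0 g x + ξ 1 * pd 1 g x := by
  conv_lhs => rw [decomp ξ]
  simp [pd]

lemma ray_zero (u : E2 → Fin 2 → Fin 2 → ℝ)
    (hu : ∀ i j, Continuous (fun x => u x i j))
    (huc : ∀ i j, HasCompactSupport (fun x => u x i j))
    (v : E2 → E2) (hv : ∀ i, Differentiable ℝ (fun x => v x i))
    (hv0 : Tendsto v (cocompact E2) (nhds 0))
    (h : ∀ x i j, u x i j = (pd i (fun y => v y j) x + pd j (fun y => v y i) x) / 2)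
    (X ξ : E2) (hξ : ξ ≠ 0) :
    (∫ t : ℝ, ∑ i : Fin 2, ∑ j : Fin 2, u (X + t • ξ) i j * ξ i * ξ j) = 0 := by
  have hcoc := (line_emb X ξ hξ).tendsto_cocompact
  have hl : ∀ t : ℝ, HasDerivAt (fun t : ℝ => X + t • ξ) ξ t := fun t => by
    simpa using ((hasDerivAt_id t).smul_const ξ).const_add X
  have hd : ∀ i (t : ℝ), HasDerivAt (fun t : ℝ => v (X + t • ξ) i)
      (fderiv ℝ (fun y => v y i) (X + t • ξ) ξ) t := fun i t =>
    ((hv i _).hasFDerivAt).comp_hasDerivAt t (hl t)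
  have hlim : Tendsto (fun t : ℝ => v (X + t • ξ) 0 * ξ 0 + v (X + t • ξ) 1 * ξ 1)
      (cocompact ℝ) (𝓝 0) := by
    have h1 := hv0.comp hcoc
    have h2 : Continuous (fun w : E2 => w 0 * ξ 0 + w 1 * ξ 1) := by fun_prop
    simpa using! (h2.tendsto 0).comp h1
  have := integral_of_hasDerivAt_of_tendsto
    (f := fun t : ℝ => v (X + t • ξ) 0 * ξ 0 + v (X + t • ξ) 1 * ξ 1)
    (f' := fun t => ∑ i : Fin 2, ∑ j : Fin 2, u (X + t • ξ) i j * ξ i * ξ j) (m := 0) (n := 0)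
    (fun t => by
      refine (((hd 0 t).mul_const (ξ 0)).add ((hd 1 t).mul_const (ξ 1))).congr_deriv ?_
      simp only [Fin.sum_univ_two, h, fderiv_pd]
      ring)
    (by
      refine integrable_finsetSum _ fun i _ => integrable_finsetSum _ fun j _ => ?_
      exact ((line_integrable _ (hu i j) (huc i j) X ξ hξ).mul_const _).mul_const _)
    (hlim.mono_left atBot_le_cocompact) (hlim.mono_left atTop_le_cocompact)
  simpa using this

/-- half-line integral -/
noncomputable def halfInt (e : E2) (g : E2 → ℝ) (x : E2) : ℝ := ∫ s in Set.Iic (0:ℝ), g (x + s • e)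

lemma halfInt_hasFDerivAt (e : E2) (he : ‖e‖ = 1) (g : E2 → ℝ) (hg : ContDiff ℝ 1 g)
    (hc : HasCompactSupport g) (x : E2) :
    HasFDerivAt (halfInt e g) (∫ s in Set.Iic (0:ℝ), fderiv ℝ g (x + s • e)) x := by
  have he0 : e ≠ 0 := by rintro rfl; simp at he
  have hcont := hg.continuous_fderiv one_ne_zero
  have hcc := hc.fderiv (𝕜 := ℝ)
  obtain ⟨C, hC⟩ := hcc.exists_bound_of_continuous hcont
  obtain ⟨R, hR⟩ := hcc.isCompact.isBounded.subset_closedBall 0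
  have hgc := hg.continuous
  refine hasFDerivAt_integral_of_dominated_of_fderiv_le (s := Metric.ball x 1)
    (F' := fun x s => fderiv ℝ g (x + s • e)) 
    (bound := (Set.Icc (-(R + ‖x‖ + 1)) (R + ‖x‖ + 1)).indicator fun _ => C)
    (Metric.ball_mem_nhds x one_pos) ?_ ?_ ?_ ?_ ?_ ?_
  · exact Eventually.of_forall fun y => (by fun_prop : Continuous fun s : ℝ => g (y + s • e)).aestronglyMeasurable
  · exact (line_integrable g hgc hc x e he0).integrableOn
  · exact (by fun_prop : Continuous fun s : ℝ => fderiv ℝ g (x + s • e)).aestronglyMeasurable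
  · refine Eventually.of_forall fun s y hy => ?_
    by_cases hs : s ∈ Set.Icc (-(R + ‖x‖ + 1)) (R + ‖x‖ + 1)
    · rw [Set.indicator_of_mem hs]; exact hC _
    · rw [Set.indicator_of_notMem hs]
      have : fderiv ℝ g (y + s • e) = 0 := by
        by_contra hne
        apply hs
        have h1 := hR (subset_tsupport _ hne)
        rw [mem_closedBall_zero_iff] at h1
        rw [mem_ball_iff_norm] at hy
        rw [Set.mem_Icc, ← abs_le]
        have h2 : ‖s • e‖ = |s| := by rw [norm_smul, he, mul_one, Real.norm_eq_abs]
        rw [← h2]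
        calc ‖s • e‖ = ‖(y + s • e) - (y - x) - x‖ := by congr 1; abel
          _ ≤ ‖y + s • e‖ + ‖y - x‖ + ‖x‖ := (norm_sub_le _ _).trans (by gcongr; exact norm_sub_le _ _)
          _ ≤ _ := by linarith
      simp [this]
  · apply Integrable.integrableOn
    rw [integrable_indicator_iff measurableSet_Icc]
    exact integrableOn_const (by simp)
  · refine Eventually.of_forall fun s y hy => ?_
    have h1 := (hg.differentiable one_ne_zero (y + s • e)).hasFDerivAt
    exact (hasFDerivAt_comp_add_right (s • e)).2 h1

lemma pd_halfInt (e : E2) (he : ‖e‖ = 1) (g : E2 → ℝ) (hg : ContDiff ℝ 1 g)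
    (hc : HasCompactSupport g) (x : E2) (i : Fin 2) :
    pd i (halfInt e g) x = halfInt e (pd i g) x := by
  have he0 : e ≠ 0 := by rintro rfl; simp at he
  rw [pd, (halfInt_hasFDerivAt e he g hg hc x).fderiv, ContinuousLinearMap.integral_apply]
  · rfl
  · exact (line_integrable _ (hg.continuous_fderiv one_ne_zero) (hc.fderiv (𝕜 := ℝ)) x e he0).integrableOn

lemma halfInt_pd_self (i : Fin 2) (g : E2 → ℝ) (hg : ContDiff ℝ 1 g)
    (hc : HasCompactSupport g) (x : E2) :
    halfInt (EuclideanSpace.single i 1) (pd i g) x = g x := by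
  set e : E2 := EuclideanSpace.single i 1 with hedef
  have he : ‖e‖ = 1 := by simp [e]
  have he0 : e ≠ 0 := by intro h; rw [h] at he; simp at he
  have hl : ∀ t : ℝ, HasDerivAt (fun t : ℝ => x + t • e) e t := fun t => by
    simpa using ((hasDerivAt_id t).smul_const e).const_add x
  have hd : ∀ t : ℝ, HasDerivAt (fun t : ℝ => g (x + t • e)) (pd i g (x + t • e)) t := fun t =>
    ((hg.differentiable one_ne_zero _).hasFDerivAt).comp_hasDerivAt t (hl t)
  have h1 := HasCompactSupport.integral_Iic_deriv_eq (f := fun t : ℝ => g (x + t • e))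
    (by fun_prop) (hc.comp_isClosedEmbedding (line_emb x e he0)) 0
  simp only [fun t => (hd t).deriv] at h1
  simpa [halfInt] using h1

lemma halfInt_compact (e : E2) (he : ‖e‖ = 1) (g : E2 → ℝ) (hg : Continuous g)
    (hc : HasCompactSupport g) (h0 : ∀ x, ∫ t : ℝ, g (x + t • e) = 0) :
    HasCompactSupport (halfInt e g) := by
  have he0 : e ≠ 0 := by rintro rfl; simp at he
  obtain ⟨R, hR⟩ := hc.isCompact.isBounded.subset_closedBall 0
  refine HasCompactSupport.intro (isCompact_closedBall (0:E2) R) fun x hx => ?_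
  by_contra hne
  apply hx
  have hint := line_integrable g hg hc x e he0
  obtain ⟨s, hs, hgs⟩ : ∃ s ≤ (0:ℝ), g (x + s • e) ≠ 0 := by
    by_contra! hcon
    exact hne (setIntegral_eq_zero_of_forall_eq_zero fun s hs => hcon s hs)
  obtain ⟨t, ht, hgt⟩ : ∃ s > (0:ℝ), g (x + s • e) ≠ 0 := by
    by_contra! hcon
    apply hne
    have h1 : ∫ s in Set.Ioi (0:ℝ), g (x + s • e) = 0 :=
      setIntegral_eq_zero_of_forall_eq_zero fun s hs => hcon s hs
    have h2 := intervalIntegral.integral_Iic_add_Ioi (b := (0:ℝ)) hint.integrableOn hint.integrableOn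
    rw [h1, h0 x, add_zero] at h2
    exact h2
  have hs' := hR (subset_tsupport _ hgs)
  have ht' := hR (subset_tsupport _ hgt)
  have hts : 0 < t - s := by linarith
  have := (convex_closedBall (0:E2) R) hs' ht' (show (0:ℝ) ≤ t / (t - s) from div_nonneg ht.le hts.le)
    (show (0:ℝ) ≤ -s / (t - s) from div_nonneg (by linarith) hts.le) (by field_simp; ring)
  convert this using 1
  ext i
  simp
  field_simp
  ring

lemma fourier_f_zero (f : E2 → ℝ) (hf : Continuous f) (hc : HasCompactSupport f)
    (h : ∀ (X : E2) (c : ℝ), c ≠ 0 → ∫ t : ℝ, f (X + t • !₂[c, 1]) = 0)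
    (w : E2) (h0 : w 0 ≠ 0) (h1 : w 1 ≠ 0) : 𝓕 (fun x => (f x : ℂ)) w = 0 := by
  have key : ∀ k : ℝ, ∃ Φ : ℝ × ℝ ≃ₜ E2, ∀ p, Φ p = !₂[p.1 - k * p.2, p.2] := fun k =>
    ⟨{ toFun := fun p => !₂[p.1 - k * p.2, p.2]
       invFun := fun x => (x 0 + k * x 1, x 1)
       left_inv := fun p => by simp
       right_inv := fun x => by ext i; fin_cases i <;> simp
       continuous_toFun := by fun_prop
       continuous_invFun := by fun_prop }, fun p => rfl⟩
  have hint : ∀ k : ℝ, ∀ G : ℝ × ℝ → ℝ, Continuous G → Integrable (fun p : ℝ × ℝ =>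
      (Real.fourierChar (G p)) • (f !₂[p.1 - k * p.2, p.2] : ℂ)) := by
    intro k G hG
    obtain ⟨Φ, hΦ⟩ := key k
    have hcs : HasCompactSupport (fun p : ℝ × ℝ => f !₂[p.1 - k * p.2, p.2]) := by
      have := hc.comp_isClosedEmbedding Φ.isClosedEmbedding
      convert this using 2 with p
      simp [hΦ]
    apply Continuous.integrable_of_hasCompactSupport
    · simp only [Circle.smul_def]
      have := Real.continuous_fourierChar
      fun_prop
    · refine hcs.mono fun p hp => ?_
      simp only [Function.mem_support] at hp ⊢
      intro h; apply hp; simp [h]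
  rw [Real.fourier_eq]
  have e1 : ∫ x : E2, Real.fourierChar (-(inner ℝ x w)) • (f x : ℂ) =
      ∫ p : ℝ × ℝ, Real.fourierChar (-(p.1 * w 0 + p.2 * w 1)) • (f !₂[p.1, p.2] : ℂ) := by
    have m1 := (volume_preserving_finTwoArrow ℝ).symm
    have m2 := PiLp.volume_preserving_toLp (Fin 2)
    rw [← m2.integral_comp (MeasurableEquiv.toLp 2 (Fin 2 → ℝ)).measurableEmbedding,
      ← m1.integral_comp (MeasurableEquiv.measurableEmbedding _)]
    congr 1; ext p
    congr 3
    simp [PiLp.inner_apply, Fin.sum_univ_two, mul_comm]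
  rw [e1, Measure.volume_eq_prod, integral_prod_symm]
  · set k := w 1 / w 0 with hk
    have e2 : ∀ b : ℝ, ∫ a : ℝ, Real.fourierChar (-(a * w 0 + b * w 1)) • (f !₂[a, b] : ℂ) =
        ∫ a : ℝ, Real.fourierChar (-(a * w 0)) • (f !₂[a - k * b, b] : ℂ) := by
      intro b
      rw [← integral_sub_right_eq_self _ (k * b)]
      congr 1; ext a
      congr 3
      rw [hk]; field_simp; ring
    simp only [e2]
    rw [integral_integral_swap]
    · rw [← integral_zero]
      congr 1; ext a
      simp only [Circle.smul_def]
      rw [integral_smul]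
      have := h !₂[a, 0] (-k) (by rw [hk]; exact neg_ne_zero.2 (div_ne_zero h1 h0))
      have e3 : ∀ b : ℝ, !₂[a - k * b, b] = !₂[a, 0] + b • !₂[-k, (1:ℝ)] := by
        intro b; ext i; fin_cases i <;> simp; ring
      simp only [e3]
      rw [integral_complex_ofReal, this]; simp
    · have := (hint k (fun p => -(p.1 * w 0)) (by fun_prop)).swap
      exact this
  · have := hint 0 (fun p => -(p.1 * w 0 + p.2 * w 1)) (by fun_prop)
    rw [Measure.volume_eq_prod] at this
    simpa using this

lemma xray_inj (f : E2 → ℝ) (hf : Continuous f) (hc : HasCompactSupport f)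
    (h : ∀ (X : E2) (c : ℝ), c ≠ 0 → ∫ t : ℝ, f (X + t • !₂[c, 1]) = 0) (x : E2) : f x = 0 := by
  have hFc : Continuous (fun x => (f x : ℂ)) := by fun_prop
  have hFi : Integrable (fun x => (f x : ℂ)) := (hf.integrable_of_hasCompactSupport hc).ofReal
  have hcont : Continuous (𝓕 (fun x => (f x : ℂ))) :=
    VectorFourier.fourierIntegral_continuous Real.continuous_fourierChar
      (by exact continuous_inner) hFi
  have hz : 𝓕 (fun x => (f x : ℂ)) = 0 := by
    ext w
    have hd : Dense ({-w 0, -w 1} : Set ℝ)ᶜ :=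
      Set.Countable.dense_compl ℝ (Set.toFinite _).countable
    have := Continuous.ext_on hd (f := fun t : ℝ => 𝓕 (fun x => (f x : ℂ)) (w + t • !₂[1, 1]))
      (g := fun _ => 0) (by fun_prop) continuous_const (fun t ht => by
        simp at ht
        apply fourier_f_zero f hf hc h
        · simp; intro h; apply ht.1; linarith
        · simp; intro h; apply ht.2; linarith)
    simpa using congrFun this 0
  have hinv := hFc.fourierInv_fourier_eq hFi (by rw [hz]; exact integrable_zero _ _ _)
  have := congrFun hinv x
  rw [hz, Real.fourierInv_eq] at this
  simpa using this.symm

/-- A smooth compactly supported symmetric 2-tensor field on `ℝ²` has vanishing ray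
transform iff it is the symmetrized derivative of a vector field vanishing at infinity. -/
theorem ray_transform_vanishes_iff_potential
    (u : EuclideanSpace ℝ (Fin 2) → Fin 2 → Fin 2 → ℝ)
    (hu : ∀ i j, ContDiff ℝ (⊤ : ℕ∞) (fun x => u x i j))
    (huc : ∀ i j, HasCompactSupport (fun x => u x i j))
    (husym : ∀ x i j, u x i j = u x j i) :
    (∀ (X ξ : EuclideanSpace ℝ (Fin 2)), ‖ξ‖ = 1 →
      (∫ t : ℝ, ∑ i : Fin 2, ∑ j : Fin 2, u (X + t • ξ) i j * ξ i * ξ j) = 0) ↔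
    (∃ v : EuclideanSpace ℝ (Fin 2) → EuclideanSpace ℝ (Fin 2),
      (∀ i, Differentiable ℝ (fun x => v x i)) ∧
      Tendsto v (cocompact (EuclideanSpace ℝ (Fin 2))) (nhds 0) ∧
      ∀ x i j, u x i j = (pd i (fun y => v y j) x + pd j (fun y => v y i) x) / 2) := by
  constructor
  · intro h
    have hu1 : ∀ i j, ContDiff ℝ 1 (fun x => u x i j) := fun i j => (hu i j).of_le (by simp)
    have hpd1 : ∀ i j k, ContDiff ℝ 1 (pd k (fun x => u x i j)) := fun i j k =>
      ((contDiff_infty_iff_fderiv.1 (hu i j)).2.of_le (by simp)).clm_apply contDiff_const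
    have hpdc : ∀ (g : E2 → ℝ) k, HasCompactSupport g → HasCompactSupport (pd k g) :=
      fun g k hg => hg.fderiv_apply (𝕜 := ℝ) _
    let e : Fin 2 → E2 := fun i => EuclideanSpace.single i 1
    have he : ∀ i, ‖e i‖ = 1 := fun i => by simp [e]
    let V : Fin 2 → E2 → ℝ := fun i => halfInt (e i) (fun x => u x i i)
    have hVd : ∀ i, Differentiable ℝ (V i) := fun i x =>
      (halfInt_hasFDerivAt _ (he i) _ (hu1 i i) (huc i i) x).differentiableAt
    have hVc : ∀ i, HasCompactSupport (V i) := fun i => by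
      refine halfInt_compact _ (he i) _ (hu1 i i).continuous (huc i i) fun x => ?_
      have := h x (e i) (he i)
      fin_cases i <;> simpa [e, Fin.sum_univ_two] using this
    have hVpd : ∀ i j, pd j (V i) = halfInt (e i) (pd j (fun x => u x i i)) := fun i j => by
      ext x; exact pd_halfInt _ (he i) _ (hu1 i i) (huc i i) x j
    have hVpdc : ∀ i j, Continuous (pd j (V i)) := fun i j => by
      rw [hVpd, continuous_iff_continuousAt]
      exact fun x => (halfInt_hasFDerivAt _ (he i) _ (hpd1 i i j) (hpdc _ _ (huc i i)) x).continuousAt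
    have hVself : ∀ i x, pd i (V i) x = u x i i := fun i x => by
      rw [hVpd]; exact halfInt_pd_self i _ (hu1 i i) (huc i i) x
    let v : E2 → E2 := fun x => !₂[V 0 x, V 1 x]
    have hv : ∀ i, (fun x => v x i) = V i := fun i => by fin_cases i <;> rfl
    have hvlim : Tendsto v (cocompact E2) (𝓝 0) := by
      have hz : ∀ i, ∀ᶠ x in cocompact E2, V i x = 0 := fun i => by
        have := hVc i
        rw [hasCompactSupport_iff_eventuallyEq, Filter.coclosedCompact_eq_cocompact] at this
        exact this
      refine tendsto_const_nhds.congr' ?_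
      filter_upwards [hz 0, hz 1] with x h0 h1
      ext i; fin_cases i <;> simp [v, h0, h1]
    let u' : E2 → Fin 2 → Fin 2 → ℝ := fun x i j => (pd i (V j) x + pd j (V i) x) / 2
    have hu'c : ∀ i j, Continuous (fun x => u' x i j) := fun i j => by
      have := hVpdc i j
      have := hVpdc j i
      simp only [u']; fun_prop
    have hu'cs : ∀ i j, HasCompactSupport (fun x => u' x i j) := fun i j =>
      ((hpdc _ i (hVc j)).add (hpdc _ j (hVc i))).comp_left (g := fun y : ℝ => y / 2) (by simp)
    have hray := ray_zero u' hu'c hu'cs v (fun i => by rw [hv]; exact hVd i) hvlim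
      (fun x i j => by rw [hv, hv])
    have hself : ∀ x i, u' x i i = u x i i := fun x i => by simp only [u', hVself]; ring
    have hu'sym : ∀ x, u' x 1 0 = u' x 0 1 := fun x => by simp only [u']; ring
    have hf : ∀ x, u x 0 1 - u' x 0 1 = 0 := by
      have hfc : Continuous (fun x => u x 0 1 - u' x 0 1) := (hu1 0 1).continuous.sub (hu'c 0 1)
      have hfcs : HasCompactSupport (fun x => u x 0 1 - u' x 0 1) := (huc 0 1).sub (hu'cs 0 1)
      refine xray_inj _ hfc hfcs ?_
      intro X c hc
      set η : E2 := !₂[c, 1] with hη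
      have hη0 : η ≠ 0 := by
        intro h; have := congrArg (fun z : E2 => z 0) h; simp [hη, hc] at this
      have hn : 0 < ‖η‖ := norm_pos_iff.2 hη0
      set ξ : E2 := ‖η‖⁻¹ • η with hξ
      have hξ1 : ‖ξ‖ = 1 := by rw [hξ, norm_smul]; simp [hn.ne']
      have hξ0 : ξ ≠ 0 := by intro h; rw [h] at hξ1; simp at hξ1
      have i1 := h X ξ hξ1
      have i2 := hray X ξ hξ0
      have int1 : ∀ i j, Integrable (fun t : ℝ => u (X + t • ξ) i j * ξ i * ξ j) := fun i j =>
        ((line_integrable _ (hu1 i j).continuous (huc i j) X ξ hξ0).mul_const _).mul_const _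
      have int2 : ∀ i j, Integrable (fun t : ℝ => u' (X + t • ξ) i j * ξ i * ξ j) := fun i j =>
        ((line_integrable _ (hu'c i j) (hu'cs i j) X ξ hξ0).mul_const _).mul_const _
      have i3 : ∫ t : ℝ, (u (X + t • ξ) 0 1 - u' (X + t • ξ) 0 1) * (2 * ξ 0 * ξ 1) = 0 := by
        rw [← sub_eq_zero.2 (i1.trans i2.symm), ← integral_sub (integrable_finsetSum _ fun i _ => integrable_finsetSum _ fun j _ => int1 i j)
          (integrable_finsetSum _ fun i _ => integrable_finsetSum _ fun j _ => int2 i j)]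
        congr 1; ext t
        simp only [Fin.sum_univ_two, hself, hu'sym, husym _ 1 0]
        ring
      rw [integral_mul_const] at i3
      have hne : 2 * ξ 0 * ξ 1 ≠ 0 := by
        simp [hξ, hη, hc]
      have i4 := (mul_eq_zero.1 i3).resolve_right hne
      have i5 := Measure.integral_comp_mul_left
        (fun t : ℝ => u (X + t • ξ) 0 1 - u' (X + t • ξ) 0 1) ‖η‖
      rw [i4, smul_zero] at i5
      rw [← i5]
      congr 1; ext t
      have : (‖η‖ * t) • ξ = t • η := by
        rw [hξ, smul_smul]; congr 1; field_simp
      rw [this]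
    refine ⟨v, fun i => by rw [hv]; exact hVd i, hvlim, fun x i j => ?_⟩
    rw [hv, hv]
    change u x i j = u' x i j
    have := hf x
    fin_cases i <;> fin_cases j
    · exact (hself x 0).symm
    · change u x 0 1 = u' x 0 1; linarith
    · change u x 1 0 = u' x 1 0; rw [husym x 1 0, hu'sym]; linarith
    · exact (hself x 1).symm
  · rintro ⟨v, hv, hv0, h⟩ X ξ hξ
    exact ray_zero u (fun i j => (hu i j).continuous) huc v hv hv0 h X ξ
      (by rintro rfl; simp at hξ)
end
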